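/- arXiv:math/0608492 — 2 statements merged into one kernel-verified Lean document; each statement's English description precedes it below -/
import Mathlib

section
/- Suppose X₁(0,0) ≠ 0. Let n ≥ 1 be an integer and let a be a rational function in x₁,x₂ that is defined (pole-free) and nonzero at (0,0), and satisfies X(a) = n·B₀·a in a neighborhood of (0,0). Then there exists a first integral ω of X at (0,0) with ω(0,0) = 0 and ∂₂ω(0,0) ≠ 0 such that (∂₂ω)ⁿ = a in a neighborhood of (0,0). -/
open Filter MvPolynomial

/-- Evaluation of a polynomial in two variables at a point of `ℂ × ℂ`. -/
noncomputable def pev (P : MvPolynomial (Fin 2) ℂ) (p : ℂ × ℂ) : ℂ :=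
  MvPolynomial.eval ![p.1, p.2] P

/-- Partial derivative with respect to the first variable. -/
noncomputable def d1 : (ℂ × ℂ → ℂ) → (ℂ × ℂ → ℂ) :=
  fun f p => deriv (fun x => f (x, p.2)) p.1

/-- Partial derivative with respect to the second variable. -/
noncomputable def d2 : (ℂ × ℂ → ℂ) → (ℂ × ℂ → ℂ) :=
  fun f p => deriv (fun y => f (p.1, y)) p.2

/-- The differential operator `X(g) = X₁·∂₁g + X₂·∂₂g`. -/
noncomputable def Xop (X₁ X₂ : MvPolynomial (Fin 2) ℂ) (f : ℂ × ℂ → ℂ) : ℂ × ℂ → ℂ :=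
  fun p => pev X₁ p * d1 f p + pev X₂ p * d2 f p

/-- A first integral of `X` at `p`: a nonconstant function, analytic near `p`,
annihilated by `X` near `p`. -/
def IsFirstIntegralAt (X₁ X₂ : MvPolynomial (Fin 2) ℂ) (ω : ℂ × ℂ → ℂ) (p : ℂ × ℂ) : Prop :=
  AnalyticAt ℂ ω p ∧ (∀ᶠ q in nhds p, Xop X₁ X₂ ω q = 0) ∧
    ¬ ∃ c : ℂ, ∀ᶠ q in nhds p, ω q = c

/-- The functions `Bᵢ = −X₁·∂₂^{i+1}(X₂/X₁)`. -/
noncomputable def B (X₁ X₂ : MvPolynomial (Fin 2) ℂ) (i : ℕ) : ℂ × ℂ → ℂ :=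
  fun p => -(pev X₁ p) * (d2^[i + 1] (fun q => pev X₂ q / pev X₁ q)) p

open scoped Topology

/-- A function whose Fréchet derivative near a point is analytic at that point is analytic there. -/
theorem analyticAt_of_hasFDerivAt_of_analyticAt {𝕜 E F : Type*} [RCLike 𝕜]
    [NormedAddCommGroup E] [NormedSpace 𝕜 E] [NormedAddCommGroup F] [NormedSpace 𝕜 F]
    [CompleteSpace F] {f : E → F} {f' : E → E →L[𝕜] F} {x : E}
    (hf : ∀ᶠ y in 𝓝 x, HasFDerivAt f (f' y) y) (hf' : AnalyticAt 𝕜 f' x) :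
    AnalyticAt 𝕜 f x := by
  let _ : NormedSpace ℝ E := .restrictScalars ℝ 𝕜 E
  let _ : NormedSpace ℝ F := .restrictScalars ℝ 𝕜 F
  obtain ⟨p, r₁, hp₁⟩ := hf'
  obtain ⟨ε, hε, hball⟩ := EMetric.mem_nhds_iff.1 hf
  set r := min r₁ ε
  have hp : HasFPowerSeriesOnBall f' p x r := hp₁.mono (lt_min hp₁.r_pos hε) (min_le_left _ _)
  have hd : ∀ y ∈ Metric.eball (0 : E) r, HasFDerivAt f (f' (x + y)) (x + y) := fun y hy ↦ by
    refine hball ?_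
    rw [mem_eball_zero_iff] at hy
    simpa [edist_eq_enorm_sub] using hy.trans_le (min_le_right _ _)
  let q : FormalMultilinearSeries 𝕜 E (E →L[𝕜] F) := fun n ↦ ((n : 𝕜) + 1)⁻¹ • p n
  have hcoe : ∀ n : ℕ, ‖((n : 𝕜) + 1)⁻¹‖ ≤ 1 := fun n ↦ by
    have h : ((n : 𝕜) + 1) = ((n + 1 : ℕ) : 𝕜) := by push_cast; rfl
    rw [h, norm_inv, RCLike.norm_natCast]
    exact inv_le_one_of_one_le₀ (by push_cast; linarith [n.cast_nonneg (α := ℝ)])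
  have hq : p.radius ≤ q.radius := by
    refine FormalMultilinearSeries.radius_le_of_le fun n ↦ ?_
    refine (norm_smul_le ((n : 𝕜) + 1)⁻¹ (p n)).trans ?_
    exact mul_le_of_le_one_left (norm_nonneg (p n)) (hcoe n)
  refine ⟨q.unshift (f x), r, ?_, hp.r_pos, ?_⟩
  · rw [FormalMultilinearSeries.radius_unshift]
    exact hp.r_le.trans hq
  intro y hy
  have hmem : ∀ t ∈ Set.Icc (0 : ℝ) 1, (t : 𝕜) • y ∈ Metric.eball (0 : E) r := fun t ht ↦ by
    rw [mem_eball_zero_iff] at hy ⊢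
    refine lt_of_le_of_lt ?_ hy
    rw [enorm_smul]
    refine mul_le_of_le_one_left' ?_
    rw [← ofReal_norm, ENNReal.ofReal_le_one, RCLike.norm_ofReal, abs_of_nonneg ht.1]
    exact ht.2
  have hderiv : ∀ t ∈ Set.uIcc (0 : ℝ) 1,
      HasDerivAt (fun t : ℝ ↦ f (x + (t : 𝕜) • y)) (f' (x + (t : 𝕜) • y) y) t := fun t ht ↦ by
    rw [Set.uIcc_of_le zero_le_one] at ht
    have h₁ : HasDerivAt (fun t : 𝕜 ↦ x + t • y) y (t : 𝕜) := by
      simpa using ((hasDerivAt_id (t : 𝕜)).smul_const y).const_add x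
    have h₂ := (hd _ (hmem t ht)).comp_hasDerivAt (t : 𝕜) h₁
    have h₃ : HasDerivAt (fun t : ℝ ↦ (t : 𝕜)) (1 : 𝕜) t := by
      simpa using (RCLike.ofRealCLM (K := 𝕜)).hasDerivAt (x := t)
    simpa [Function.comp_def] using h₂.scomp t h₃
  have hsum : ∀ t ∈ Set.Icc (0 : ℝ) 1,
      HasSum (fun n ↦ (t : 𝕜) ^ n • p n (fun _ ↦ y) y) (f' (x + (t : 𝕜) • y) y) := fun t ht ↦ by
    have h := (hp.hasSum (hmem t ht)).mapL (ContinuousLinearMap.apply 𝕜 F y)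
    refine h.congr_fun fun n ↦ ?_
    have hpow := (p n).map_smul_univ (fun _ ↦ (t : 𝕜)) (fun _ ↦ y)
    rw [Finset.prod_const, Finset.card_univ, Fintype.card_fin] at hpow
    simp only [ContinuousLinearMap.apply_apply, hpow, smul_apply]
  have hcont : ContinuousOn (fun t : ℝ ↦ f' (x + (t : 𝕜) • y) y) (Set.uIcc 0 1) := fun t ht ↦ by
    rw [Set.uIcc_of_le zero_le_one] at ht
    have hft : ContinuousAt f' (x + (t : 𝕜) • y) :=
      (hp.analyticAt_of_mem (by simpa [edist_eq_enorm_sub] using hmem t ht)).continuousAt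
    have hcomp : ContinuousAt (fun t : ℝ ↦ f' (x + (t : 𝕜) • y)) t :=
      ContinuousAt.comp (f := fun t : ℝ ↦ x + (t : 𝕜) • y) hft (by fun_prop)
    exact (hcomp.clm_apply continuousAt_const).continuousWithinAt
  have hint : HasSum (fun n ↦ ∫ t : ℝ in 0..1, (t : 𝕜) ^ n • p n (fun _ ↦ y) y)
      (∫ t : ℝ in 0..1, f' (x + (t : 𝕜) • y) y) := by
    have hs : Summable fun n ↦ ‖p n fun _ ↦ y‖ * ‖y‖ :=
      (p.summable_norm_apply (Metric.eball_subset_eball hp.r_le hy)).mul_right _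
    refine intervalIntegral.hasSum_integral_of_dominated_convergence
      (fun n _ ↦ ‖p n fun _ ↦ y‖ * ‖y‖) (fun n ↦ ?_) (fun n ↦ ?_) ?_ ?_ ?_
    · exact Continuous.aestronglyMeasurable (by fun_prop)
    · refine .of_forall fun t ht ↦ ?_
      rw [Set.uIoc_of_le zero_le_one] at ht
      rw [norm_smul, norm_pow, RCLike.norm_ofReal, abs_of_nonneg ht.1.le]
      exact (mul_le_of_le_one_left (norm_nonneg _) (pow_le_one₀ ht.1.le ht.2)).trans
        ((p n fun _ ↦ y).le_opNorm y)
    · exact .of_forall fun _ _ ↦ hs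
    · exact intervalIntegrable_const
    · refine .of_forall fun t ht ↦ hsum t ?_
      rw [Set.uIoc_of_le zero_le_one] at ht
      exact ⟨ht.1.le, ht.2⟩
  rw [intervalIntegral.integral_eq_sub_of_hasDerivAt hderiv hcont.intervalIntegrable] at hint
  rw [← hasSum_nat_add_iff' 1]
  have h0 : f (x + y) - ∑ i ∈ Finset.range 1, q.unshift (f x) i (fun _ ↦ y)
      = f (x + ((1 : ℝ) : 𝕜) • y) - f (x + ((0 : ℝ) : 𝕜) • y) := by
    simp [FormalMultilinearSeries.unshift]
  rw [h0]
  refine hint.congr_fun fun n ↦ ?_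
  rw [intervalIntegral.integral_smul_const]
  have hpow : ∫ t : ℝ in 0..1, (t : 𝕜) ^ n = ((n : 𝕜) + 1)⁻¹ := by
    simp only [← RCLike.ofReal_pow]
    rw [RCLike.intervalIntegral_ofReal, integral_pow]
    simp
  rw [hpow]
  simp [FormalMultilinearSeries.unshift, q, Fin.init_def]

/-- **Poincaré lemma** for analytic 1-forms: an analytic closed 1-form has locally an analytic
primitive. -/
theorem exists_analyticAt_hasFDerivAt_of_fderiv_symmetric {E F : Type*}
    [NormedAddCommGroup E] [NormedSpace ℂ E] [NormedAddCommGroup F] [NormedSpace ℂ F]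
    [CompleteSpace F] {η : E → E →L[ℂ] F} {x : E} (hη : AnalyticAt ℂ η x)
    (hsymm : ∀ᶠ y in 𝓝 x, ∀ u v, fderiv ℂ η y u v = fderiv ℂ η y v u) :
    ∃ f : E → F, AnalyticAt ℂ f x ∧ f x = 0 ∧ ∀ᶠ y in 𝓝 x, HasFDerivAt f (η y) y := by
  obtain ⟨ε, hε, hball⟩ := Metric.eventually_nhds_iff_ball.1 (hη.eventually_analyticAt.and hsymm)
  let _ : NormedSpace ℝ E := .restrictScalars ℝ ℂ E
  have hb : ∀ y ∈ Metric.ball x ε, Metric.ball x ε ∈ 𝓝 y :=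
    fun y hy ↦ Metric.isOpen_ball.mem_nhds hy
  obtain ⟨f, hf⟩ := (convex_ball x ε).exists_forall_hasFDerivWithinAt_of_hasFDerivWithinAt_symmetric
    (ω := η) (dω := fun y ↦ (fderiv ℂ η y).restrictScalars ℝ)
    (fun y hy ↦ ((hball y hy).1.differentiableAt.hasFDerivAt.restrictScalars ℝ).hasFDerivWithinAt)
    (fun y hy u _ v _ ↦ (hball y hy).2 u v)
  have hprim : ∀ᶠ y in 𝓝 x, HasFDerivAt (fun z ↦ f z - f x) (η y) y := by
    filter_upwards [Metric.ball_mem_nhds x hε] with y hy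
    exact ((hf y hy).hasFDerivAt (hb y hy)).sub_const _
  exact ⟨_, analyticAt_of_hasFDerivAt_of_analyticAt hprim hη, sub_self _, hprim⟩

/-- An analytic function not vanishing at a point has locally analytic `n`-th roots. -/
theorem AnalyticAt.exists_analyticAt_pow_eq {E : Type*} [NormedAddCommGroup E] [NormedSpace ℂ E]
    {a : E → ℂ} {x : E} (ha : AnalyticAt ℂ a x) (hx : a x ≠ 0) {n : ℕ} (hn : n ≠ 0) :
    ∃ g : E → ℂ, AnalyticAt ℂ g x ∧ ∀ y, g y ^ n = a y := by
  refine ⟨fun y ↦ a x ^ (n : ℂ)⁻¹ * (a y / a x) ^ (n : ℂ)⁻¹, ?_, fun y ↦ ?_⟩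
  · exact analyticAt_const.mul ((ha.div analyticAt_const hx).cpow analyticAt_const
      (by simp [div_self hx]))
  · rw [mul_pow, Complex.cpow_nat_inv_pow _ hn, Complex.cpow_nat_inv_pow _ hn, mul_div_cancel₀ _ hx]

theorem analyticAt_pev (P : MvPolynomial (Fin 2) ℂ) (p : ℂ × ℂ) : AnalyticAt ℂ (pev P) p := by
  have h : AnalyticAt ℂ (fun q : ℂ × ℂ ↦ aeval ![q.1, q.2] P) p := by
    refine AnalyticAt.aeval_mvPolynomial (fun i ↦ ?_) P
    fin_cases i
    · exact analyticAt_fst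
    · exact analyticAt_snd
  exact h

theorem HasFDerivAt.d1_eq {f : ℂ × ℂ → ℂ} {f' : ℂ × ℂ →L[ℂ] ℂ} {p : ℂ × ℂ}
    (h : HasFDerivAt f f' p) : d1 f p = f' (1, 0) :=
  (HasFDerivAt.comp_hasDerivAt p.1 (f := fun x ↦ (x, p.2)) h
    ((hasDerivAt_id p.1).prodMk (hasDerivAt_const p.1 p.2))).deriv

theorem HasFDerivAt.d2_eq {f : ℂ × ℂ → ℂ} {f' : ℂ × ℂ →L[ℂ] ℂ} {p : ℂ × ℂ}
    (h : HasFDerivAt f f' p) : d2 f p = f' (0, 1) :=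
  (HasFDerivAt.comp_hasDerivAt p.2 (f := fun y ↦ (p.1, y)) h
    ((hasDerivAt_const p.2 p.1).prodMk (hasDerivAt_id p.2))).deriv

/-- The 1-form `u dx₁ + v dx₂` with `∂₂u = ∂₁v` has locally an analytic primitive. -/
theorem exists_analyticAt_d1_eq_d2_eq {u v : ℂ × ℂ → ℂ} {p : ℂ × ℂ} (hu : AnalyticAt ℂ u p)
    (hv : AnalyticAt ℂ v p)
    (huv : ∀ᶠ q in 𝓝 p, fderiv ℂ u q (0, 1) = fderiv ℂ v q (1, 0)) :
    ∃ f : ℂ × ℂ → ℂ, AnalyticAt ℂ f p ∧ f p = 0 ∧ ∀ᶠ q in 𝓝 p, d1 f q = u q ∧ d2 f q = v q := by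
  obtain ⟨f, hf, hfp, hfd⟩ := exists_analyticAt_hasFDerivAt_of_fderiv_symmetric
    (η := fun q ↦ u q • ContinuousLinearMap.fst ℂ ℂ ℂ + v q • ContinuousLinearMap.snd ℂ ℂ ℂ)
    ((hu.smul analyticAt_const).add (hv.smul analyticAt_const)) (by
      filter_upwards [huv, hu.eventually_analyticAt, hv.eventually_analyticAt] with q hq hu hv
      have hη := (hu.differentiableAt.hasFDerivAt.smul_const (ContinuousLinearMap.fst ℂ ℂ ℂ)).add
        (hv.differentiableAt.hasFDerivAt.smul_const (ContinuousLinearMap.snd ℂ ℂ ℂ))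
      have hdec : ∀ (L : ℂ × ℂ →L[ℂ] ℂ) (w : ℂ × ℂ), L w = w.1 * L (1, 0) + w.2 * L (0, 1) := by
        intro L w
        rw [← smul_eq_mul, ← smul_eq_mul, ← map_smul, ← map_smul, ← map_add]
        simp
      intro w z
      erw [HasFDerivAt.fderiv hη]
      simp only [add_apply, ContinuousLinearMap.smulRight_apply, smul_apply,
        ContinuousLinearMap.coe_fst', ContinuousLinearMap.coe_snd', smul_eq_mul]
      rw [hdec (fderiv ℂ u q) w, hdec (fderiv ℂ v q) w, hdec (fderiv ℂ u q) z,
        hdec (fderiv ℂ v q) z, hq]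
      ring)
  refine ⟨f, hf, hfp, hfd.mono fun q hq ↦ ⟨?_, ?_⟩⟩
  · simp [hq.d1_eq]
  · simp [hq.d2_eq]

/-- a pole-free rational solution `a = P/Q`, nonzero at `(0,0)`, of
`X(a) = n·B₀·a` yields a first integral `ω ∈ Ω¹` with `(∂₂ω)ⁿ = a` near `(0,0)`. -/
theorem stmt_15 (X₁ X₂ : MvPolynomial (Fin 2) ℂ)
    (hX₁ : pev X₁ ((0 : ℂ), (0 : ℂ)) ≠ 0)
    (n : ℕ) (hn : 1 ≤ n)
    (P Q : MvPolynomial (Fin 2) ℂ)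
    (hQ : pev Q ((0 : ℂ), (0 : ℂ)) ≠ 0) (hP : pev P ((0 : ℂ), (0 : ℂ)) ≠ 0)
    (hXa : ∀ᶠ q in nhds ((0 : ℂ), (0 : ℂ)),
      Xop X₁ X₂ (fun r => pev P r / pev Q r) q
        = (n : ℂ) * B X₁ X₂ 0 q * (pev P q / pev Q q)) :
    ∃ ω : ℂ × ℂ → ℂ, IsFirstIntegralAt X₁ X₂ ω ((0 : ℂ), (0 : ℂ)) ∧
      ω ((0 : ℂ), (0 : ℂ)) = 0 ∧ d2 ω ((0 : ℂ), (0 : ℂ)) ≠ 0 ∧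
      ∀ᶠ q in nhds ((0 : ℂ), (0 : ℂ)), d2 ω q ^ n = pev P q / pev Q q := by
  have hn0 : n ≠ 0 := Nat.one_le_iff_ne_zero.1 hn
  set a : ℂ × ℂ → ℂ := fun r ↦ pev P r / pev Q r
  set f : ℂ × ℂ → ℂ := fun r ↦ pev X₂ r / pev X₁ r with hf_def
  have ha : AnalyticAt ℂ a (0, 0) := (analyticAt_pev P _).div (analyticAt_pev Q _) hQ
  have ha0 : a (0, 0) ≠ 0 := div_ne_zero hP hQ
  have hf : AnalyticAt ℂ f (0, 0) := (analyticAt_pev X₂ _).div (analyticAt_pev X₁ _) hX₁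
  obtain ⟨g, hg, hga⟩ := ha.exists_analyticAt_pow_eq ha0 hn0
  have hg0 : g (0, 0) ≠ 0 := fun h ↦ ha0 (by rw [← hga, h, zero_pow hn0])
  have hX₁' := (analyticAt_pev X₁ (0, 0)).continuousAt.eventually_ne hX₁
  obtain ⟨ω, hω, hω0, hωd⟩ := exists_analyticAt_d1_eq_d2_eq (hf.mul hg).neg hg (by
    filter_upwards [hXa, hf.eventually_analyticAt, hg.eventually_analyticAt, hX₁',
      hg.continuousAt.eventually_ne hg0] with q hq hf hg hX₁ hg0
    have hf' := hf.differentiableAt.hasFDerivAt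
    have hg' := hg.differentiableAt.hasFDerivAt
    have ha' := hg'.pow n
    rw [show (fun y ↦ g y ^ n) = a from funext hga] at ha'
    have hB : B X₁ X₂ 0 q = -(pev X₁ q) * fderiv ℂ f q (0, 1) := by
      rw [← hf'.d2_eq]; rfl
    have hX₂ : pev X₂ q = pev X₁ q * f q := (mul_div_cancel₀ _ hX₁).symm
    rw [HasFDerivAt.fderiv (hf'.mul hg').neg]
    have hq' : Xop X₁ X₂ a q = n * B X₁ X₂ 0 q * a q := hq
    rw [Xop, ha'.d1_eq, ha'.d2_eq, hB, ← hga, hX₂, ← pow_sub_one_mul hn0 (g q)] at hq'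
    have hc : pev X₁ q * n * g q ^ (n - 1) ≠ 0 :=
      mul_ne_zero (mul_ne_zero hX₁ (Nat.cast_ne_zero.2 hn0)) (pow_ne_zero _ hg0)
    simp only [neg_apply, add_apply, smul_apply,
      smul_eq_mul, nsmul_eq_mul] at hq' ⊢
    refine mul_left_cancel₀ hc ?_
    linear_combination -hq')
  have hd2 : d2 ω (0, 0) ≠ 0 := by rwa [hωd.self_of_nhds.2]
  refine ⟨ω, ⟨hω, ?_, ?_⟩, hω0, hd2, ?_⟩
  · filter_upwards [hωd, hX₁'] with q hq hX₁
    simp only [Xop, hq.1, hq.2, Pi.neg_apply, Pi.mul_apply, hf_def]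
    field_simp
    ring
  · rintro ⟨c, hc⟩
    refine hd2 ?_
    have : HasFDerivAt ω (0 : ℂ × ℂ →L[ℂ] ℂ) (0, 0) :=
      (hasFDerivAt_const c _).congr_of_eventuallyEq hc
    simp [this.d2_eq]
  · filter_upwards [hωd] with q hq
    rw [hq.2, hga]
end

section
/- Suppose X₁(0,0) ≠ 0, let ω be a first integral of X at (0,0), and let a₁, a₂ be rational functions in x₁,x₂, defined (pole-free) in a neighborhood of (0,0), such that ∂₁²ω = a₁·∂₁ω and ∂₂²ω = a₂·∂₂ω in a neighborhood of (0,0). Define μ := −∂₂ω/X₁ (analytic near (0,0)). Then, in a neighborhood of (0,0), ∂₁ω = μ·X₂, ∂₂ω = −μ·X₁, X₂·∂₁μ = (a₁·X₂ − ∂₁X₂)·μ, and X₁·∂₂μ = (a₂·X₁ − ∂₂X₁)·μ; in particular the logarithmic derivatives of the integrating factor μ are rational wherever μ, X₁, X₂ are nonzero. -/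
open Filter MvPolynomial

theorem MvPolynomial.hasDerivAt_eval_update {σ : Type*} [DecidableEq σ]
    (P : MvPolynomial σ ℂ) (c : σ → ℂ) (i : σ) (t : ℂ) :
    HasDerivAt (fun s => eval (Function.update c i s) P)
      (eval (Function.update c i t) (pderiv i P)) t := by
  induction P using MvPolynomial.induction_on with
  | C a => simpa using hasDerivAt_const t a
  | add p q hp hq => simpa using hp.fun_add hq
  | mul_X p j hp =>
    have hX : HasDerivAt (fun s => Function.update c i s j) (Pi.single (M := fun _ => ℂ) i 1 j) t :=
      hasDerivAt_pi.1 (hasDerivAt_update c i t) j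
    have h := hp.fun_mul hX
    simp only [map_mul, eval_X, Derivation.leibniz, smul_eq_mul, map_add, pderiv_X]
    refine h.congr_deriv ?_
    rcases eq_or_ne i j with rfl | hij
    · simp
      ring
    · simp [Pi.single_eq_of_ne hij.symm, mul_comm]

theorem hasDerivAt_pev_fst (P : MvPolynomial (Fin 2) ℂ) (q : ℂ × ℂ) :
    HasDerivAt (fun x => pev P (x, q.2)) (pev (pderiv 0 P) q) q.1 := by
  have hu (s : ℂ) : Function.update ![q.1, q.2] 0 s = ![s, q.2] := by
    ext j; fin_cases j <;> simp
  simpa only [hu, pev] using P.hasDerivAt_eval_update ![q.1, q.2] 0 q.1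

theorem hasDerivAt_pev_snd (P : MvPolynomial (Fin 2) ℂ) (q : ℂ × ℂ) :
    HasDerivAt (fun y => pev P (q.1, y)) (pev (pderiv 1 P) q) q.2 := by
  have hu (s : ℂ) : Function.update ![q.1, q.2] 1 s = ![q.1, s] := by
    ext j; fin_cases j <;> simp
  simpa only [hu, pev] using P.hasDerivAt_eval_update ![q.1, q.2] 1 q.2

theorem continuous_pev (P : MvPolynomial (Fin 2) ℂ) : Continuous (pev P) := by
  unfold pev
  refine P.continuous_eval.comp (continuous_pi fun j => ?_)
  fin_cases j
  · exact continuous_fst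
  · exact continuous_snd

theorem d2_eq_fderiv {f : ℂ × ℂ → ℂ} {p : ℂ × ℂ} (hf : DifferentiableAt ℂ f p) :
    d2 f p = fderiv ℂ f p (0, 1) :=
  (hf.hasFDerivAt.comp_hasDerivAt p.2
    ((hasDerivAt_const p.2 p.1).prodMk (hasDerivAt_id p.2))).deriv

theorem AnalyticAt.differentiableAt_d2 {f : ℂ × ℂ → ℂ} {p : ℂ × ℂ} (hf : AnalyticAt ℂ f p) :
    DifferentiableAt ℂ (d2 f) p := by
  refine DifferentiableAt.congr_of_eventuallyEq
    (hf.fderiv.differentiableAt.clm_apply (differentiableAt_const (0, 1))) ?_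
  filter_upwards [hf.eventually_analyticAt] with q hq using d2_eq_fderiv hq.differentiableAt

theorem d1_congr {f g : ℂ × ℂ → ℂ} {p : ℂ × ℂ} (h : f =ᶠ[nhds p] g) : d1 f p = d1 g p :=
  Filter.EventuallyEq.deriv_eq <|
    (show Continuous fun x : ℂ => (x, p.2) by fun_prop).continuousAt.eventually h

theorem d2_congr {f g : ℂ × ℂ → ℂ} {p : ℂ × ℂ} (h : f =ᶠ[nhds p] g) : d2 f p = d2 g p :=
  Filter.EventuallyEq.deriv_eq <|
    (show Continuous fun y : ℂ => (p.1, y) by fun_prop).continuousAt.eventually h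

theorem d1_mul_pev {f : ℂ × ℂ → ℂ} {p : ℂ × ℂ} (P : MvPolynomial (Fin 2) ℂ)
    (hf : DifferentiableAt ℂ (fun x => f (x, p.2)) p.1) :
    d1 (fun q => f q * pev P q) p = d1 f p * pev P p + f p * pev (pderiv 0 P) p :=
  (hf.hasDerivAt.mul (hasDerivAt_pev_fst P p)).deriv

theorem d2_mul_pev {f : ℂ × ℂ → ℂ} {p : ℂ × ℂ} (P : MvPolynomial (Fin 2) ℂ)
    (hf : DifferentiableAt ℂ (fun y => f (p.1, y)) p.2) :
    d2 (fun q => f q * pev P q) p = d2 f p * pev P p + f p * pev (pderiv 1 P) p :=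
  (hf.hasDerivAt.mul (hasDerivAt_pev_snd P p)).deriv

/-- if `∂₁²ω = a₁·∂₁ω` and `∂₂²ω = a₂·∂₂ω` with `a₁ = P₁/Q₁`, `a₂ = P₂/Q₂`
pole-free rational, then the integrating factor `μ = −∂₂ω/X₁` satisfies
`∂₁ω = μ·X₂`, `∂₂ω = −μ·X₁`, `X₂·∂₁μ = (a₁·X₂ − ∂₁X₂)·μ`, `X₁·∂₂μ = (a₂·X₁ − ∂₂X₁)·μ`. -/
theorem stmt_17 (X₁ X₂ : MvPolynomial (Fin 2) ℂ)
    (hX₁ : pev X₁ ((0 : ℂ), (0 : ℂ)) ≠ 0)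
    (ω : ℂ × ℂ → ℂ) (hω : IsFirstIntegralAt X₁ X₂ ω ((0 : ℂ), (0 : ℂ)))
    (P₁ Q₁ P₂ Q₂ : MvPolynomial (Fin 2) ℂ)
    (hQ₁ : pev Q₁ ((0 : ℂ), (0 : ℂ)) ≠ 0) (hQ₂ : pev Q₂ ((0 : ℂ), (0 : ℂ)) ≠ 0)
    (h1 : ∀ᶠ q in nhds ((0 : ℂ), (0 : ℂ)),
      d1 (d1 ω) q = (pev P₁ q / pev Q₁ q) * d1 ω q)
    (h2 : ∀ᶠ q in nhds ((0 : ℂ), (0 : ℂ)),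
      d2 (d2 ω) q = (pev P₂ q / pev Q₂ q) * d2 ω q) :
    ∀ᶠ q in nhds ((0 : ℂ), (0 : ℂ)),
      d1 ω q = (-(d2 ω q) / pev X₁ q) * pev X₂ q ∧
      d2 ω q = -((-(d2 ω q) / pev X₁ q) * pev X₁ q) ∧
      pev X₂ q * d1 (fun r => -(d2 ω r) / pev X₁ r) q
        = ((pev P₁ q / pev Q₁ q) * pev X₂ q - pev (pderiv (0 : Fin 2) X₂) q)
            * (-(d2 ω q) / pev X₁ q) ∧
      pev X₁ q * d2 (fun r => -(d2 ω r) / pev X₁ r) q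
        = ((pev P₂ q / pev Q₂ q) * pev X₁ q - pev (pderiv (1 : Fin 2) X₁) q)
            * (-(d2 ω q) / pev X₁ q) := by
  obtain ⟨han, hX, -⟩ := hω
  have hne : ∀ᶠ q in nhds ((0 : ℂ), (0 : ℂ)), pev X₁ q ≠ 0 :=
    (continuous_pev X₁).continuousAt.eventually_ne hX₁
  set μ : ℂ × ℂ → ℂ := fun r => -(d2 ω r) / pev X₁ r with hμ
  have hfst : ∀ᶠ q in nhds ((0 : ℂ), (0 : ℂ)), d1 ω q = μ q * pev X₂ q := by
    filter_upwards [hX, hne] with q hq hn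
    simp only [Xop] at hq
    simp only [hμ]
    field_simp
    linear_combination hq
  have hsnd : ∀ᶠ q in nhds ((0 : ℂ), (0 : ℂ)), -d2 ω q = μ q * pev X₁ q := by
    filter_upwards [hne] with q hn
    simp only [hμ]
    field_simp
  filter_upwards [han.eventually_analyticAt, hne, hfst.eventually_nhds, hsnd.eventually_nhds,
    h1, h2] with q hq hn hf hs h1q h2q
  have hd := hq.differentiableAt_d2
  have hμ₁ : DifferentiableAt ℂ (fun x => μ (x, q.2)) q.1 :=
    (DifferentiableAt.comp (g := d2 ω) (f := fun x => (x, q.2)) q.1 hd (by fun_prop)).neg.div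
      (hasDerivAt_pev_fst X₁ q).differentiableAt hn
  have hμ₂ : DifferentiableAt ℂ (fun y => μ (q.1, y)) q.2 :=
    (DifferentiableAt.comp (g := d2 ω) (f := fun y => (q.1, y)) q.2 hd (by fun_prop)).neg.div
      (hasDerivAt_pev_snd X₁ q).differentiableAt hn
  have e1 := (d1_congr hf).trans (d1_mul_pev X₂ hμ₁)
  have e2 := (d2_congr hs).trans (d2_mul_pev X₁ hμ₂)
  have e3 : d2 (fun r => -d2 ω r) q = -d2 (d2 ω) q := deriv.fun_neg
  have hf' := hf.self_of_nhds
  have hs' := hs.self_of_nhds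
  change d1 ω q = μ q * pev X₂ q ∧ d2 ω q = -(μ q * pev X₁ q) ∧
    pev X₂ q * d1 μ q = (pev P₁ q / pev Q₁ q * pev X₂ q - pev (pderiv 0 X₂) q) * μ q ∧
    pev X₁ q * d2 μ q = (pev P₂ q / pev Q₂ q * pev X₁ q - pev (pderiv 1 X₁) q) * μ q
  refine ⟨hf', by linear_combination -hs', ?_, ?_⟩
  · linear_combination h1q - e1 + (pev P₁ q / pev Q₁ q) * hf'
  · linear_combination e3 - e2 - h2q + (pev P₂ q / pev Q₂ q) * hs'
end
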